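/- For every fixed integer R > 2 there exists N such that for every n ≥ N there is a connected graph G on n vertices whose speed-R cop number satisfies c_R(G) ≥ n^{1 - 1/(R-2)}. -/

import Mathlib

/-!
Speed-`R` Cops and Robbers.  Cops are placed first (several may share a
vertex), then the robber chooses a starting vertex; play proceeds in rounds
with the cops moving first.  Each cop moves to an adjacent vertex or stays
put; the robber may traverse any walk of at most `R` edges from his current
vertex that does not pass through any vertex currently occupied by a cop.
-/

/-- A legal simultaneous move of the cops: each cop stays put or moves to an
adjacent vertex. -/
def CopMove {V : Type*} (G : SimpleGraph V) {c : ℕ} (C C' : Fin c → V) : Prop :=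
  ∀ i, C' i = C i ∨ G.Adj (C i) (C' i)

/-- A legal move of a speed-`R` robber from `u` to `v`, with the cops at
positions `C`: a walk of at most `R` edges all of whose vertices after the
starting one avoid the cops. -/
def RobberMoveR {V : Type*} (G : SimpleGraph V) {c : ℕ} (C : Fin c → V) (R : ℕ)
    (u v : V) : Prop :=
  ∃ k : ℕ, k ≤ R ∧ ∃ f : ℕ → V, f 0 = u ∧ f k = v ∧
    (∀ i, i < k → G.Adj (f i) (f (i + 1))) ∧
    (∀ i, 0 < i → i ≤ k → ∀ j, C j ≠ f i)

/-- `CopsWinR G R c C r`: with cops at positions `C`, a speed-`R` robber at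
`r`, and the cops to move, the `c` cops can force a capture. -/
inductive CopsWinR {V : Type*} (G : SimpleGraph V) (R : ℕ) (c : ℕ) :
    (Fin c → V) → V → Prop
  | catch (C C' : Fin c → V) (r : V) (hm : CopMove G C C') (i : Fin c)
      (hi : C' i = r) : CopsWinR G R c C r
  | step (C C' : Fin c → V) (r : V) (hm : CopMove G C C')
      (h : ∀ r', RobberMoveR G C' R r r' → CopsWinR G R c C' r') : CopsWinR G R c C r

/-- The speed-`R` cop number: the least number of cops having a winning
strategy against a robber of speed `R`. -/
noncomputable def copNumberR {V : Type*} (G : SimpleGraph V) (R : ℕ) : ℕ :=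
  sInf {c : ℕ | ∃ C₀ : Fin c → V, ∀ r : V, CopsWinR G R c C₀ r}


/-- `1`-Lipschitz sequences can be followed by a robber: repeated vertices are skipped. -/
theorem robberMoveR_of_lazy_walk {V : Type*} (G : SimpleGraph V) {c : ℕ} (C : Fin c → V)
    (p : ℕ → V) (k : ℕ) (hstep : ∀ j < k, p (j + 1) = p j ∨ G.Adj (p j) (p (j + 1)))
    (hC : ∀ j ≤ k, ∀ i, C i ≠ p j) : RobberMoveR G C k (p 0) (p k) := by
  induction k with
  | zero => exact ⟨0, le_rfl, p, rfl, rfl, by simp, by intro i h0 h1; omega⟩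
  | succ k ih =>
    obtain ⟨l, hl, f, h0, hlast, hadj, hav⟩ :=
      ih (fun j hj => hstep j (by omega)) (fun j hj => hC j (by omega))
    rcases hstep k (by omega) with h | h
    · exact ⟨l, by omega, f, h0, by rw [hlast, h], hadj, hav⟩
    · refine ⟨l + 1, by omega, fun j => if j ≤ l then f j else p (k + 1), by simp [h0],
        by simp, ?_, ?_⟩
      · intro j hj
        rcases Nat.lt_or_ge j l with h' | h'
        · have : j + 1 ≤ l := h'
          simpa [h'.le, this] using hadj j h'
        · obtain rfl : j = l := by omega
          simpa [hlast] using h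
      · intro j hj hj' i
        by_cases h' : j ≤ l
        · simpa [h'] using hav j hj h' i
        · simpa [h'] using hC (k + 1) le_rfl i

theorem RobberMoveR.mono {V : Type*} {G : SimpleGraph V} {c : ℕ} {C : Fin c → V} {k R : ℕ}
    {u v : V} (h : RobberMoveR G C k u v) (hk : k ≤ R) : RobberMoveR G C R u v := by
  obtain ⟨l, hl, h⟩ := h
  exact ⟨l, hl.trans hk, h⟩

/-- With a cop on every vertex the cops win at once. -/
theorem copNumberR_set_nonempty {n : ℕ} (G : SimpleGraph (Fin n)) (R : ℕ) :
    {c : ℕ | ∃ C₀ : Fin c → Fin n, ∀ r, CopsWinR G R c C₀ r}.Nonempty :=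
  ⟨n, id, fun r => .catch id id r (fun _ => .inl rfl) r rfl⟩

section RouteSystem

variable {V B : Type*} [Fintype V] [Fintype B]

open scoped Classical in
/-- The number of (route, time) pairs at which a route out of `v` visits `u`, for the system of
routes `p j v b` (position at time `j ≤ k` of the route from `v` labelled `b`). -/
noncomputable def visitCount (p : ℕ → V → B → V) (k : ℕ) (v u : V) : ℕ :=
  ∑ j ∈ Finset.range (k + 1), (Finset.univ.filter fun b => p j v b = u).card

open scoped Classical in
/-- The closed neighbourhood of a vertex. -/
noncomputable def closedNbhd (G : SimpleGraph V) (u : V) : Finset V :=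
  Finset.univ.filter fun w => w = u ∨ G.Adj u w

/-- The total number of visits of routes out of `v` to vertices the cops can occupy after their
next move. -/
noncomputable def threat (G : SimpleGraph V) (p : ℕ → V → B → V) (k : ℕ) {c : ℕ}
    (C : Fin c → V) (v : V) : ℕ :=
  ∑ i, ∑ u ∈ closedNbhd G (C i), visitCount p k v u

theorem sum_visitCount_le (p : ℕ → V → B → V) (k : ℕ)
    (hhit : ∀ j ≤ k, ∀ u : V,
      {x : V × B | p j x.1 x.2 = u}.ncard ≤ Fintype.card B) (u : V) :
    ∑ v, visitCount p k v u ≤ (k + 1) * Fintype.card B := by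
  classical
  unfold visitCount
  rw [Finset.sum_comm]
  calc _ ≤ ∑ j ∈ Finset.range (k + 1), Fintype.card B := by
        refine Finset.sum_le_sum fun j hj => ?_
        refine le_trans (le_of_eq ?_) (hhit j (by simpa [Nat.lt_succ_iff] using hj) u)
        rw [Set.ncard_eq_toFinset_card']
        simp only [Set.toFinset_ofPred, Finset.card_filter, Fintype.sum_prod_type]
    _ = _ := by simp

theorem sum_threat_le (G : SimpleGraph V) (p : ℕ → V → B → V) (k Δ : ℕ)
    (hhit : ∀ j ≤ k, ∀ u : V, {x : V × B | p j x.1 x.2 = u}.ncard ≤ Fintype.card B)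
    (hdeg : ∀ u, (closedNbhd G u).card ≤ Δ) {c : ℕ} (C : Fin c → V) :
    ∑ v, threat G p k C v ≤ c * Δ * (k + 1) * Fintype.card B := by
  unfold threat
  rw [Finset.sum_comm]
  calc _ ≤ ∑ i : Fin c, Δ * ((k + 1) * Fintype.card B) := by
        refine Finset.sum_le_sum fun i _ => ?_
        rw [Finset.sum_comm]
        calc _ ≤ ∑ u ∈ closedNbhd G (C i), (k + 1) * Fintype.card B :=
              Finset.sum_le_sum fun u _ => sum_visitCount_le p k hhit u
          _ ≤ _ := by
              rw [Finset.sum_const, smul_eq_mul]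
              exact Nat.mul_le_mul_right _ (hdeg _)
    _ = _ := by simp [mul_assoc]

open scoped Classical in
/-- Only few vertices are heavily threatened. -/
theorem card_unsafe_le [Nonempty B] (G : SimpleGraph V) (p : ℕ → V → B → V) (k Δ : ℕ)
    (hhit : ∀ j ≤ k, ∀ u : V, {x : V × B | p j x.1 x.2 = u}.ncard ≤ Fintype.card B)
    (hdeg : ∀ u, (closedNbhd G u).card ≤ Δ) {c : ℕ} (C : Fin c → V) :
    (Finset.univ.filter fun v => Fintype.card B ≤ 2 * threat G p k C v).card ≤
      2 * (c * Δ * (k + 1)) := by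
  have h1 := sum_threat_le G p k Δ hhit hdeg C
  have h2 : (Finset.univ.filter fun v => Fintype.card B ≤ 2 * threat G p k C v).card *
      Fintype.card B ≤ 2 * ∑ v, threat G p k C v := by
    rw [Finset.mul_sum, ← smul_eq_mul]
    refine (Finset.card_nsmul_le_sum _ (fun v => 2 * threat G p k C v) _ ?_).trans
      (Finset.sum_le_sum_of_subset (Finset.filter_subset _ _))
    intro v hv
    simpa using hv
  refine Nat.le_of_mul_le_mul_right (h2.trans ?_) (Fintype.card_pos (α := B))
  rw [mul_assoc]
  exact Nat.mul_le_mul_left 2 h1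

omit [Fintype V] in
theorem card_le_visitCount_self (p : ℕ → V → B → V) (k : ℕ) (h0 : ∀ v b, p 0 v b = v) (v : V) :
    Fintype.card B ≤ visitCount p k v v := by
  classical
  unfold visitCount
  refine le_trans (le_of_eq ?_) (Finset.single_le_sum (fun _ _ => Nat.zero_le _)
    (Finset.mem_range.2 (Nat.succ_pos k)))
  simp [h0]

theorem sum_visitCount_le_threat (G : SimpleGraph V) (p : ℕ → V → B → V) (k : ℕ) {c : ℕ}
    {C C' : Fin c → V} (hm : CopMove G C C') (v : V) :
    ∑ i, visitCount p k v (C' i) ≤ threat G p k C v := by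
  classical
  refine Finset.sum_le_sum fun i _ => ?_
  refine Finset.single_le_sum (f := fun u => visitCount p k v u) (fun _ _ => Nat.zero_le _) ?_
  simpa [closedNbhd] using hm i

omit [Fintype V] in
open scoped Classical in
/-- The number of routes out of `v` that meet a cop is at most the number of visits to cops. -/
theorem card_blocked_le (p : ℕ → V → B → V) (k : ℕ) {c : ℕ} (C : Fin c → V) (v : V) :
    (Finset.univ.filter fun b => ∃ j ≤ k, ∃ i, C i = p j v b).card ≤
      ∑ i, visitCount p k v (C i) := by
  have : (Finset.univ.filter fun b => ∃ j ≤ k, ∃ i, C i = p j v b) ⊆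
      Finset.univ.biUnion fun i => (Finset.range (k + 1)).biUnion fun j =>
        Finset.univ.filter fun b => p j v b = C i := by
    intro b hb
    obtain ⟨j, hj, i, hi⟩ := by simpa using hb
    simp only [Finset.mem_biUnion, Finset.mem_filter, Finset.mem_univ, true_and,
      Finset.mem_range]
    exact ⟨i, j, by omega, hi.symm⟩
  refine (Finset.card_le_card this).trans (Finset.card_biUnion_le.trans ?_)
  exact Finset.sum_le_sum fun i _ => Finset.card_biUnion_le

/-- If a graph has a system of routes of length `k ≤ R`, labelled by `B`, such that the routes out
of a vertex end at distinct vertices and are equidistributed at every time, then a speed-`R` robber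
evades fewer than `|B| / (4 Δ (k + 1))` cops, where `Δ` bounds the closed neighbourhoods. -/
theorem card_le_of_copsWinR [Nonempty B] [Nonempty V] (G : SimpleGraph V)
    (p : ℕ → V → B → V) (k R Δ : ℕ) (hkR : k ≤ R) (h0 : ∀ v b, p 0 v b = v)
    (hstep : ∀ v b, ∀ j < k, p (j + 1) v b = p j v b ∨ G.Adj (p j v b) (p (j + 1) v b))
    (hinj : ∀ v, Function.Injective (p k v))
    (hhit : ∀ j ≤ k, ∀ u : V, {x : V × B | p j x.1 x.2 = u}.ncard ≤ Fintype.card B)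
    (hdeg : ∀ u, (closedNbhd G u).card ≤ Δ) {c : ℕ} (C₀ : Fin c → V)
    (hwin : ∀ r, CopsWinR G R c C₀ r) :
    Fintype.card B ≤ 4 * (c * Δ * (k + 1)) := by
  classical
  by_contra! hlt
  have key : ∀ C r, CopsWinR G R c C r → Fintype.card B ≤ 2 * threat G p k C r := by
    intro C r h
    induction h with
    | step C C' r hm _ ih =>
      by_contra! hs
      have h1 := (card_blocked_le p k C' r).trans (sum_visitCount_le_threat G p k hm r)
      have h2 := Finset.card_filter_add_card_filter_not (s := (Finset.univ : Finset B))
        (fun b => ∃ j ≤ k, ∃ i, C' i = p j r b)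
      have h3 : (Finset.univ.filter fun b => ¬ ∃ j ≤ k, ∃ i, C' i = p j r b).card ≤
          (Finset.univ.filter fun v => Fintype.card B ≤ 2 * threat G p k C' v).card := by
        refine Finset.card_le_card_of_injOn (p k r) ?_ (hinj r).injOn
        intro b hb
        have hb' : ∀ j ≤ k, ∀ i, C' i ≠ p j r b := by simpa using hb
        have hmv := robberMoveR_of_lazy_walk G C' (fun j => p j r b) k (hstep r b) hb'
        rw [h0] at hmv
        simpa using ih _ (hmv.mono hkR)
      have h4 := card_unsafe_le G p k Δ hhit hdeg C'
      rw [Finset.card_univ] at h2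
      omega
    | _ C C' r hm i hi =>
      have h1 := sum_visitCount_le_threat G p k hm r
      have h2 := Finset.single_le_sum (f := fun i => visitCount p k r (C' i))
        (fun _ _ => Nat.zero_le _) (Finset.mem_univ i)
      have h3 := card_le_visitCount_self p k h0 r
      simp only [hi] at h2
      omega
  have h4 := card_unsafe_le G p k Δ hhit hdeg C₀
  rw [Finset.filter_true_of_mem fun v _ => key C₀ v (hwin v), Finset.card_univ] at h4
  have h5 := Fintype.card_le_of_injective _ (hinj (Classical.arbitrary V))
  omega

end RouteSystem

/-- The generalized de Bruijn graph on `Fin n`: `x` is joined to `q x + a` modulo `n`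
for `a < q`. -/
def deBruijn (n q : ℕ) : SimpleGraph (Fin n) :=
  SimpleGraph.fromRel fun x y => ∃ a < q, (q * x + a) % n = y

/-- The position at time `j` of the directed walk of length `k` from `v` in the generalized
de Bruijn graph whose appended base-`q` digits are those of `b`. -/
def deBruijnRoute (n q k : ℕ) [NeZero n] (j : ℕ) (v : Fin n) (b : Fin (q ^ k)) : Fin n :=
  ⟨(q ^ j * v + b / q ^ (k - j)) % n, Nat.mod_lt _ (NeZero.pos n)⟩

theorem deBruijn_connected (n q : ℕ) [NeZero n] (hq : 2 ≤ q) : (deBruijn n q).Connected := by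
  have hz : ∀ m (h : m < n), (deBruijn n q).Reachable ⟨m, h⟩ ⟨0, NeZero.pos n⟩ := by
    intro m
    induction m using Nat.strong_induction_on with
    | _ m ih =>
      intro h
      rcases Nat.eq_zero_or_pos m with rfl | hm
      · exact .refl _
      · have hlt : m / q < m := Nat.div_lt_self hm hq
        refine SimpleGraph.Reachable.trans (SimpleGraph.Adj.reachable ?_)
          (ih (m / q) hlt (hlt.trans h))
        rw [deBruijn, SimpleGraph.fromRel_adj]
        refine ⟨by simp [Fin.ext_iff, hlt.ne'], .inr ⟨m % q, Nat.mod_lt _ (by omega), ?_⟩⟩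
        simp [Nat.div_add_mod, Nat.mod_eq_of_lt h]
  exact ⟨fun u v => (hz u u.2).trans (hz v v.2).symm⟩

theorem deBruijnRoute_zero (n q k : ℕ) [NeZero n] (v : Fin n) (b : Fin (q ^ k)) :
    deBruijnRoute n q k 0 v b = v := by
  ext
  simp [deBruijnRoute, Nat.div_eq_of_lt b.2, Nat.mod_eq_of_lt v.2]

theorem deBruijnRoute_succ (n q k : ℕ) [NeZero n] (hq : 0 < q) (v : Fin n) (b : Fin (q ^ k))
    (j : ℕ) (hj : j < k) :
    deBruijnRoute n q k (j + 1) v b = deBruijnRoute n q k j v b ∨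
      (deBruijn n q).Adj (deBruijnRoute n q k j v b) (deBruijnRoute n q k (j + 1) v b) := by
  by_cases h : deBruijnRoute n q k (j + 1) v b = deBruijnRoute n q k j v b
  · exact .inl h
  refine .inr ?_
  rw [deBruijn, SimpleGraph.fromRel_adj]
  refine ⟨Ne.symm h, .inl ⟨(b / q ^ (k - (j + 1))) % q, Nat.mod_lt _ hq, ?_⟩⟩
  have hd : (b : ℕ) / q ^ (k - j) = b / q ^ (k - (j + 1)) / q := by
    rw [Nat.div_div_eq_div_mul, ← pow_succ]
    congr 2
    omega
  have hb := Nat.div_add_mod ((b : ℕ) / q ^ (k - (j + 1))) q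
  simp only [deBruijnRoute, hd]
  rw [Nat.add_mod, Nat.mul_mod, Nat.mod_mod, ← Nat.mul_mod, ← Nat.add_mod]
  congr 1
  rw [pow_succ]
  linear_combination hb

theorem deBruijnRoute_injective (n q k : ℕ) [NeZero n] (hn : q ^ k ≤ n) (v : Fin n) :
    Function.Injective (deBruijnRoute n q k k v) := by
  intro b b' h
  have h' : (q ^ k * v + b) ≡ (q ^ k * v + b') [MOD n] := by
    simpa [deBruijnRoute, Fin.ext_iff, Nat.ModEq] using h
  exact Fin.ext ((Nat.ModEq.add_left_cancel' _ h').eq_of_lt_of_lt (b.2.trans_le hn)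
    (b'.2.trans_le hn))

theorem ncard_deBruijnRoute_le (n q k : ℕ) [NeZero n] (hq : 0 < q) (j : ℕ) (hj : j ≤ k)
    (u : Fin n) :
    {x : Fin n × Fin (q ^ k) | deBruijnRoute n q k j x.1 x.2 = u}.ncard ≤
      Fintype.card (Fin (q ^ k)) := by
  have hcard : ((Finset.range (q ^ j) ×ˢ Finset.range (q ^ (k - j)) : Finset (ℕ × ℕ)) :
      Set (ℕ × ℕ)).ncard = Fintype.card (Fin (q ^ k)) := by
    rw [Set.ncard_coe_finset, Finset.card_product, Finset.card_range, Finset.card_range,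
      ← pow_add, Nat.add_sub_cancel' hj, Fintype.card_fin]
  have hlt : ∀ b : Fin (q ^ k), (b : ℕ) / q ^ (k - j) < q ^ j := fun b => by
    rw [Nat.div_lt_iff_lt_mul (by positivity), ← pow_add, Nat.add_sub_cancel' hj]
    exact b.2
  rw [← hcard]
  refine Set.ncard_le_ncard_of_injOn
    (fun x => ((q ^ j * (x.1 : ℕ) + x.2 / q ^ (k - j)) / n, (x.2 : ℕ) % q ^ (k - j)))
    ?_ ?_ (Finset.finite_toSet _)
  · rintro ⟨v, b⟩ -
    simp only [Finset.coe_product, Finset.coe_range, Set.mem_prod, Set.mem_Iio]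
    refine ⟨?_, Nat.mod_lt _ (by positivity)⟩
    rw [Nat.div_lt_iff_lt_mul (NeZero.pos n)]
    have h1 := hlt b
    have h2 : q ^ j * ((v : ℕ) + 1) ≤ q ^ j * n := Nat.mul_le_mul_left _ v.2
    rw [mul_add] at h2
    omega
  · rintro ⟨v, b⟩ hx ⟨v', b'⟩ hx' h
    simp only [Set.mem_ofPred_eq, deBruijnRoute, Fin.ext_iff] at hx hx'
    simp only [Prod.mk.injEq] at h
    obtain ⟨hdiv, hmod⟩ := h
    have heq : q ^ j * (v : ℕ) + b / q ^ (k - j) = q ^ j * (v' : ℕ) + b' / q ^ (k - j) := by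
      rw [← Nat.div_add_mod (q ^ j * (v : ℕ) + b / q ^ (k - j)) n, hdiv, hx, ← hx',
        Nat.div_add_mod]
    have hpos : 0 < q ^ j := by positivity
    have hv : (v : ℕ) = v' := by
      have := congrArg (· / q ^ j) heq
      simpa [Nat.mul_add_div hpos, Nat.div_eq_of_lt (hlt b), Nat.div_eq_of_lt (hlt b')] using this
    rw [hv, Nat.add_left_cancel_iff] at heq
    have hb : (b : ℕ) = b' := by
      rw [← Nat.div_add_mod (b : ℕ) (q ^ (k - j)), heq, hmod, Nat.div_add_mod]
    exact Prod.ext (Fin.ext hv) (Fin.ext hb)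

theorem card_closedNbhd_deBruijn_le (n q : ℕ) [NeZero n] (hq : 0 < q) (u : Fin n) :
    (closedNbhd (deBruijn n q) u).card ≤ 3 * q := by
  classical
  have hin : (Finset.univ.filter fun x : Fin n × Fin (q ^ 1) =>
      deBruijnRoute n q 1 1 x.1 x.2 = u).card ≤ q := by
    have := ncard_deBruijnRoute_le n q 1 hq 1 le_rfl u
    rw [Set.ncard_eq_toFinset_card'] at this
    simpa using this
  have hout : ((Finset.univ : Finset (Fin (q ^ 1))).image fun b =>
      deBruijnRoute n q 1 1 u b).card ≤ q := by
    simpa using Finset.card_image_le (s := (Finset.univ : Finset (Fin (q ^ 1))))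
      (f := fun b => deBruijnRoute n q 1 1 u b)
  have hsub : closedNbhd (deBruijn n q) u ⊆ {u} ∪
      (((Finset.univ : Finset (Fin (q ^ 1))).image fun b => deBruijnRoute n q 1 1 u b) ∪
      (Finset.univ.filter fun x : Fin n × Fin (q ^ 1) =>
        deBruijnRoute n q 1 1 x.1 x.2 = u).image Prod.fst) := by
    intro w hw
    simp only [closedNbhd, Finset.mem_filter, Finset.mem_univ, true_and] at hw
    simp only [Finset.mem_union, Finset.mem_singleton, Finset.mem_image, Finset.mem_filter,
      Finset.mem_univ, true_and]
    rcases hw with hw | hw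
    · exact .inl hw
    · rw [deBruijn, SimpleGraph.fromRel_adj] at hw
      rcases hw.2 with ⟨a, ha, h⟩ | ⟨a, ha, h⟩
      · exact .inr (.inl ⟨⟨a, by simpa using ha⟩, by simpa [deBruijnRoute, Fin.ext_iff] using h⟩)
      · exact .inr (.inr ⟨(w, ⟨a, by simpa using ha⟩),
          by simpa [deBruijnRoute, Fin.ext_iff] using h, rfl⟩)
  have h1 := Finset.card_le_card hsub
  have h2 := Finset.card_union_le {u}
    (((Finset.univ : Finset (Fin (q ^ 1))).image fun b => deBruijnRoute n q 1 1 u b) ∪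
      (Finset.univ.filter fun x : Fin n × Fin (q ^ 1) =>
        deBruijnRoute n q 1 1 x.1 x.2 = u).image Prod.fst)
  have h3 := Finset.card_union_le
    ((Finset.univ : Finset (Fin (q ^ 1))).image fun b => deBruijnRoute n q 1 1 u b)
    ((Finset.univ.filter fun x : Fin n × Fin (q ^ 1) =>
        deBruijnRoute n q 1 1 x.1 x.2 = u).image Prod.fst)
  have h4 := (Finset.card_image_le (f := Prod.fst) (s := Finset.univ.filter
    fun x : Fin n × Fin (q ^ 1) => deBruijnRoute n q 1 1 x.1 x.2 = u)).trans hin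
  rw [Finset.card_singleton] at h2
  omega

theorem pow_le_copNumberR_deBruijn (n q k R : ℕ) [NeZero n] (hq : 0 < q) (hn : q ^ k ≤ n)
    (hkR : k ≤ R) :
    q ^ k ≤ 12 * (k + 1) * q * copNumberR (deBruijn n q) R := by
  have : NeZero (q ^ k) := ⟨by positivity⟩
  obtain ⟨C₀, hwin⟩ := Nat.sInf_mem (copNumberR_set_nonempty (deBruijn n q) R)
  have h := card_le_of_copsWinR (deBruijn n q) (deBruijnRoute n q k) k R (3 * q) hkR
    (deBruijnRoute_zero n q k) (deBruijnRoute_succ n q k hq) (deBruijnRoute_injective n q k hn)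
    (ncard_deBruijnRoute_le n q k hq) (card_closedNbhd_deBruijn_le n q hq) C₀ hwin
  rw [Fintype.card_fin] at h
  calc q ^ k ≤ _ := h
    _ = _ := by rw [copNumberR]; ring

/-- Every natural number lies between consecutive perfect powers. -/
theorem exists_pow_le_lt_succ_pow (n k : ℕ) (hk : k ≠ 0) : ∃ q, q ^ k ≤ n ∧ n < (q + 1) ^ k := by
  have hex : ∃ m, n < (m + 1) ^ k := ⟨n, n.lt_succ_self.trans_le (Nat.le_self_pow hk _)⟩
  classical
  refine ⟨Nat.find hex, ?_, Nat.find_spec hex⟩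
  rcases h : Nat.find hex with _ | m
  · simp [hk]
  · exact not_lt.1 (Nat.find_min hex (h ▸ m.lt_succ_self))

/-- The arithmetic behind the choice of degree `q` of order `n ^ (1 / (s + 1))`. -/
theorem pow_le_pow_of_degree_bound {n q s A c : ℕ} (hs : 0 < s) (hA : 0 < A)
    (hn : n ≤ (2 * q) ^ (s + 1)) (hlarge : 2 ^ (s ^ 2) * A ^ s ≤ q) (hc : q ^ s ≤ A * c) :
    n ^ (s - 1) ≤ c ^ s := by
  obtain ⟨t, rfl⟩ : ∃ t, s = t + 1 := ⟨s - 1, by omega⟩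
  refine Nat.le_of_mul_le_mul_left ?_ (show 0 < A ^ (t + 1) by positivity)
  calc A ^ (t + 1) * n ^ (t + 1 - 1) ≤ A ^ (t + 1) * ((2 * q) ^ (t + 1 + 1)) ^ t := by
        rw [Nat.add_sub_cancel]; gcongr
    _ = A ^ (t + 1) * 2 ^ ((t + 2) * t) * q ^ ((t + 2) * t) := by
        rw [← pow_mul, mul_pow]; ring
    _ ≤ A ^ (t + 1) * 2 ^ ((t + 1) ^ 2) * q ^ ((t + 2) * t) := by
        gcongr
        · norm_num
        · nlinarith
    _ ≤ q * q ^ ((t + 2) * t) := by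
        rw [mul_comm (A ^ (t + 1))]; gcongr
    _ = (q ^ (t + 1)) ^ (t + 1) := by rw [← pow_mul]; ring
    _ ≤ (A * c) ^ (t + 1) := by gcongr
    _ = A ^ (t + 1) * c ^ (t + 1) := mul_pow _ _ _

/-- For every fixed integer speed `R > 2` and all sufficiently large `n`,
there is a connected graph on `n` vertices whose speed-`R` cop number is at
least `n^(1 - 1/(R-2))`. -/
theorem copNumberR_lower_bound (R : ℕ) (hR : 2 < R) :
    ∃ N : ℕ, ∀ n : ℕ, N ≤ n →
      ∃ G : SimpleGraph (Fin n), G.Connected ∧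
        (n : ℝ) ^ (1 - 1 / ((R : ℝ) - 2)) ≤ (copNumberR G R : ℝ) := by
  obtain ⟨s, rfl⟩ : ∃ s, R = s + 2 := ⟨R - 2, by omega⟩
  have hs : 0 < s := by omega
  set A := 12 * (s + 2) with hA
  set K := 2 ^ (s ^ 2) * A ^ s with hK
  have hK2 : 2 ≤ K := by
    calc 2 = 2 ^ 1 * 1 := by norm_num
      _ ≤ K := by
        rw [hK]
        gcongr
        · norm_num
        · exact Nat.one_le_iff_ne_zero.2 (by positivity)
        · exact Nat.one_le_iff_ne_zero.2 (by positivity)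
  refine ⟨K ^ (s + 1), fun n hn => ?_⟩
  have hn0 : 0 < n := lt_of_lt_of_le (by positivity) hn
  have : NeZero n := ⟨hn0.ne'⟩
  obtain ⟨q, hq, hq'⟩ := exists_pow_le_lt_succ_pow n (s + 1) (by omega)
  have hKq : K ≤ q := Nat.lt_succ_iff.1 (lt_of_pow_lt_pow_left₀ _ (Nat.zero_le _)
    (hn.trans_lt hq'))
  refine ⟨deBruijn n q, deBruijn_connected n q (hK2.trans hKq), ?_⟩
  have hcop := pow_le_copNumberR_deBruijn n q (s + 1) (s + 2) (by omega) hq (by omega)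
  set c := copNumberR (deBruijn n q) (s + 2)
  have hc : q ^ s ≤ A * c := by
    refine Nat.le_of_mul_le_mul_right (c := q) ?_ (by omega)
    calc q ^ s * q = q ^ (s + 1) := (pow_succ _ _).symm
      _ ≤ _ := hcop
      _ = A * c * q := by rw [hA]; ring
  have hle : n ≤ (2 * q) ^ (s + 1) :=
    hq'.le.trans (Nat.pow_le_pow_left (by omega) _)
  have hpow := pow_le_pow_of_degree_bound hs (by omega) hle hKq hc
  have hsR : (0 : ℝ) < s := by exact_mod_cast hs
  have hexp : (1 - 1 / (((s + 2 : ℕ) : ℝ) - 2)) * s = ((s - 1 : ℕ) : ℝ) := by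
    push_cast [Nat.cast_sub (show 1 ≤ s from hs)]
    rw [add_sub_cancel_right]
    field_simp
  refine le_of_pow_le_pow_left₀ hs.ne' (Nat.cast_nonneg c) ?_
  rw [← Real.rpow_natCast, ← Real.rpow_mul (Nat.cast_nonneg n), hexp, Real.rpow_natCast]
  exact_mod_cast hpow
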